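/- For every λ ∈ (0,1) there exist constants α ∈ (0,1/2), γ ∈ (0,1) and c_5 > 0, depending only on λ, with the following property: for every nonempty finite CNN request sequence σ' whose last request is r' = r(x',y') and every extension σ'' = σ', r(x'',y'') with |x'−x''| ≥ |y'−y''|, such that F_{W_{σ''}} and G_{W_{σ''}} attain their infima over M³, the potential Φ_σ = (1−γ)·inf F_{W_σ} + γ·inf G_{W_σ} satisfies Φ_{σ''} − Φ_{σ'} ≥ c_5·∇, where ∇ = sup_{s∈M} Sl_{W_{σ'}}(s; r(x'',y'')). -/

import Mathlib

noncomputable section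

/-- The L1 metric on `ℝ²` (the CNN metric space). -/
def dL1 (p q : ℝ × ℝ) : ℝ := |p.1 - q.1| + |p.2 - q.2|

/-- The CNN request associated with a point `(x, y)`. -/
def req (p : ℝ × ℝ) : Set (ℝ × ℝ) := {q | q.1 = p.1 ∨ q.2 = p.2}

/-- The work function of a finite CNN request sequence (requests listed in order of arrival),
starting at origin `O`. -/
noncomputable def WF (O : ℝ × ℝ) : List (ℝ × ℝ) → (ℝ × ℝ) → ℝ
  | [], s => dL1 O s
  | p :: l, s => sInf ((fun t => dL1 O t + WF t l s) '' req p)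

/-- The slack of a point `s` to a nonempty set `C` with respect to `W`. -/
noncomputable def Sl (lam : ℝ) (W : ℝ × ℝ → ℝ) (s : ℝ × ℝ) (C : Set (ℝ × ℝ)) : ℝ :=
  sInf ((fun t => W t + lam * dL1 t s) '' C) - W s

/-- The rectangle spanned by two points of `ℝ²`. -/
def Boks (s1 s2 : ℝ × ℝ) : Set (ℝ × ℝ) :=
  {p | p.1 ∈ Set.uIcc s1.1 s2.1 ∧ p.2 ∈ Set.uIcc s1.2 s2.2}

/-- `H_W(s₁,s₂) = (1/2)W(s₁) + (1/2)W(s₂) − (λ/2)d(s₁,s₂)`. -/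
noncomputable def Hf (lam : ℝ) (W : ℝ × ℝ → ℝ) (s1 s2 : ℝ × ℝ) : ℝ :=
  (1 / 2) * W s1 + (1 / 2) * W s2 - (lam / 2) * dL1 s1 s2

/-- `F_W(s₁,s₂,s₃) = H_W(s₁,s₂) − α·Sl_W(s₃;{s₁,s₂})`. -/
noncomputable def Ff (lam α : ℝ) (W : ℝ × ℝ → ℝ) (s1 s2 s3 : ℝ × ℝ) : ℝ :=
  Hf lam W s1 s2 - α * Sl lam W s3 {s1, s2}

/-- `G_W(s₁,s₂,s₃) = H_W(s₁,s₂) − α·Sl_W(s₃;Boks(s₁,s₂))`. -/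
noncomputable def Gf (lam α : ℝ) (W : ℝ × ℝ → ℝ) (s1 s2 s3 : ℝ × ℝ) : ℝ :=
  Hf lam W s1 s2 - α * Sl lam W s3 (Boks s1 s2)

/-- `inf_{M³} F_W`. -/
noncomputable def infF (lam α : ℝ) (W : ℝ × ℝ → ℝ) : ℝ :=
  sInf (Set.range fun q : (ℝ × ℝ) × (ℝ × ℝ) × (ℝ × ℝ) => Ff lam α W q.1 q.2.1 q.2.2)

/-- `inf_{M³} G_W`. -/
noncomputable def infG (lam α : ℝ) (W : ℝ × ℝ → ℝ) : ℝ :=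
  sInf (Set.range fun q : (ℝ × ℝ) × (ℝ × ℝ) × (ℝ × ℝ) => Gf lam α W q.1 q.2.1 q.2.2)

/-- The potential `Φ = (1−γ)·inf F_W + γ·inf G_W`. -/
noncomputable def Phi (lam α γ : ℝ) (W : ℝ × ℝ → ℝ) : ℝ :=
  (1 - γ) * infF lam α W + γ * infG lam α W

/-! ### Basic facts on the metric -/

lemma dL1_nonneg (p q : ℝ × ℝ) : 0 ≤ dL1 p q := by unfold dL1; positivity

lemma dL1_self (p : ℝ × ℝ) : dL1 p p = 0 := by simp [dL1]

lemma dL1_comm (p q : ℝ × ℝ) : dL1 p q = dL1 q p := by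
  simp only [dL1, abs_sub_comm]

lemma dL1_tri (p q r : ℝ × ℝ) : dL1 p r ≤ dL1 p q + dL1 q r := by
  have h1 := abs_sub_le p.1 q.1 r.1
  have h2 := abs_sub_le p.2 q.2 r.2
  unfold dL1; linarith

lemma req_nonempty (p : ℝ × ℝ) : (req p).Nonempty := ⟨p, Or.inl rfl⟩

lemma req_closed (p : ℝ × ℝ) : IsClosed (req p) :=
  (isClosed_eq continuous_fst continuous_const).union
    (isClosed_eq continuous_snd continuous_const)

lemma continuous_of_lip {W : ℝ × ℝ → ℝ} (hl : ∀ s t, W s ≤ W t + dL1 t s) : Continuous W := by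
  have : LipschitzWith 2 W := by
    apply LipschitzWith.of_dist_le_mul
    intro x y
    have h1 := hl x y
    have h2 := hl y x
    rw [dL1_comm] at h1
    have h3 : dL1 x y ≤ 2 * dist x y := by
      have e1 : |x.1 - y.1| ≤ dist x y := by rw [← Real.dist_eq, Prod.dist_eq]; exact le_max_left _ _
      have e2 : |x.2 - y.2| ≤ dist x y := by rw [← Real.dist_eq, Prod.dist_eq]; exact le_max_right _ _
      unfold dL1; linarith
    rw [Real.dist_eq]
    refine abs_le.2 ⟨?_, ?_⟩ <;> push_cast <;> linarith
  exact this.continuous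

lemma continuous_dL1_left (s : ℝ × ℝ) : Continuous (fun t => dL1 t s) := by
  unfold dL1; fun_prop

lemma exists_min_req {W : ℝ × ℝ → ℝ} {O : ℝ × ℝ} (hl : ∀ s t, W s ≤ W t + dL1 t s)
    (hO : ∀ s, dL1 O s ≤ W s) {μ : ℝ} (hμ : 0 ≤ μ) (p s : ℝ × ℝ) :
    ∃ t ∈ req p, ∀ t' ∈ req p, W t + μ * dL1 t s ≤ W t' + μ * dL1 t' s := by
  have hc : Continuous (fun t => W t + μ * dL1 t s) :=
    (continuous_of_lip hl).add (continuous_const.mul (continuous_dL1_left s))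
  have hp : p ∈ req p := Or.inl rfl
  obtain ⟨t, ht, hm⟩ := hc.continuousOn.exists_isMinOn' (req_closed p) hp (by
    apply Filter.Eventually.filter_mono inf_le_left
    have := (tendsto_norm_cocompact_atTop (E := ℝ × ℝ)).eventually_ge_atTop
      (W p + μ * dL1 p s + ‖O‖)
    filter_upwards [this] with x hx
    have h1 := hO x
    have h2 := mul_nonneg hμ (dL1_nonneg x s)
    have h3 : ‖x‖ ≤ ‖O‖ + ‖x - O‖ := by
      have := norm_add_le O (x - O); simpa using this
    have h4 : ‖x - O‖ ≤ dL1 O x := by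
      rw [Prod.norm_def, dL1_comm]
      unfold dL1
      apply max_le
      · rw [Real.norm_eq_abs]
        simp
      · rw [Real.norm_eq_abs]
        simp
    linarith)
  exact ⟨t, ht, fun t' ht' => hm ht'⟩

/-! ### Work functions -/

lemma WF_ge (l : List (ℝ × ℝ)) : ∀ O s, dL1 O s ≤ WF O l s := by
  induction l with
  | nil => intro O s; exact le_rfl
  | cons p l ih =>
    intro O s
    apply le_csInf ((req_nonempty p).image _)
    rintro _ ⟨t, -, rfl⟩
    have := ih t s
    have := dL1_tri O t s
    simp only
    linarith

lemma WF_bdd (p : ℝ × ℝ) (l : List (ℝ × ℝ)) (O s) :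
    BddBelow ((fun t => dL1 O t + WF t l s) '' req p) := by
  refine ⟨0, ?_⟩
  rintro _ ⟨t, -, rfl⟩
  have := WF_ge l t s
  have := dL1_nonneg t s
  have := dL1_nonneg O t
  simp only
  linarith

lemma WF_cons_le (p : ℝ × ℝ) (l : List (ℝ × ℝ)) (O s t) (ht : t ∈ req p) :
    WF O (p :: l) s ≤ dL1 O t + WF t l s :=
  csInf_le (WF_bdd p l O s) ⟨t, ht, rfl⟩

lemma le_WF_cons (p : ℝ × ℝ) (l : List (ℝ × ℝ)) (O s) (x : ℝ)
    (h : ∀ t ∈ req p, x ≤ dL1 O t + WF t l s) : x ≤ WF O (p :: l) s := by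
  apply le_csInf ((req_nonempty p).image _)
  rintro _ ⟨t, ht, rfl⟩
  exact h t ht

lemma WF_lip (l : List (ℝ × ℝ)) : ∀ O s t, WF O l s ≤ WF O l t + dL1 t s := by
  induction l with
  | nil => intro O s t; exact dL1_tri O t s
  | cons p l ih =>
    intro O s t
    have : WF O (p :: l) s - dL1 t s ≤ WF O (p :: l) t := by
      apply le_WF_cons
      intro u hu
      have := WF_cons_le p l O s u hu
      have := ih u s t
      linarith
    linarith

/-- Attained form of the recursion from the last request. -/
lemma WF_snoc (p : ℝ × ℝ) (l : List (ℝ × ℝ)) : ∀ O s,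
    (∀ t ∈ req p, WF O (l ++ [p]) s ≤ WF O l t + dL1 t s) ∧
    (∀ x : ℝ, (∀ t ∈ req p, x ≤ WF O l t + dL1 t s) → x ≤ WF O (l ++ [p]) s) := by
  induction l with
  | nil =>
    intro O s
    refine ⟨fun t ht => WF_cons_le p [] O s t ht, fun x hx => le_WF_cons p [] O s x hx⟩
  | cons q l ih =>
    intro O s
    constructor
    · intro t ht
      have : WF O (q :: (l ++ [p])) s - dL1 t s ≤ WF O (q :: l) t := by
        apply le_WF_cons
        intro u hu
        have := WF_cons_le q (l ++ [p]) O s u hu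
        have := (ih u s).1 t ht
        linarith
      simp only [List.cons_append]
      linarith
    · intro x hx
      simp only [List.cons_append]
      apply le_WF_cons
      intro u hu
      have : x - dL1 O u ≤ WF u (l ++ [p]) s := by
        apply (ih u s).2
        intro t ht
        have := hx t ht
        have := WF_cons_le q l O t u hu
        linarith
      linarith

lemma WF_snoc_attained (p : ℝ × ℝ) (l : List (ℝ × ℝ)) (O s) :
    ∃ t ∈ req p, WF O (l ++ [p]) s = WF O l t + dL1 t s := by
  obtain ⟨t, ht, hm⟩ := exists_min_req (WF_lip l O) (WF_ge l O) zero_le_one p s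
  refine ⟨t, ht, le_antisymm ((WF_snoc p l O s).1 t ht) ((WF_snoc p l O s).2 _ ?_)⟩
  intro t' ht'
  have := hm t' ht'
  linarith

lemma WF_snoc_ge (p : ℝ × ℝ) (l : List (ℝ × ℝ)) (O s) : WF O l s ≤ WF O (l ++ [p]) s :=
  (WF_snoc p l O s).2 _ fun t _ => WF_lip l O s t

lemma WF_snoc_eq (p : ℝ × ℝ) (l : List (ℝ × ℝ)) (O s) (hs : s ∈ req p) :
    WF O (l ++ [p]) s = WF O l s := by
  apply le_antisymm _ (WF_snoc_ge p l O s)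
  have := (WF_snoc p l O s).1 s hs
  rw [dL1_self] at this
  linarith

lemma WF_snoc_rep (p : ℝ × ℝ) (l : List (ℝ × ℝ)) (O s) :
    ∃ t ∈ req p, WF O (l ++ [p]) s = WF O (l ++ [p]) t + dL1 t s := by
  obtain ⟨t, ht, h⟩ := WF_snoc_attained p l O s
  exact ⟨t, ht, by rw [h, WF_snoc_eq p l O t ht]⟩

/-! ### Slack -/

lemma Sl_le {lam : ℝ} {W : ℝ × ℝ → ℝ} {O s t : ℝ × ℝ} {C : Set (ℝ × ℝ)} (h0 : 0 ≤ lam)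
    (hO : ∀ s, dL1 O s ≤ W s) (ht : t ∈ C) : Sl lam W s C ≤ W t + lam * dL1 t s - W s := by
  unfold Sl
  have : sInf ((fun t => W t + lam * dL1 t s) '' C) ≤ W t + lam * dL1 t s := by
    apply csInf_le
    · refine ⟨0, ?_⟩
      rintro _ ⟨u, -, rfl⟩
      have := hO u
      have := dL1_nonneg O u
      have := mul_nonneg h0 (dL1_nonneg u s)
      simp only
      linarith
    · exact ⟨t, ht, rfl⟩
  linarith

lemma le_Sl {lam : ℝ} {W : ℝ × ℝ → ℝ} {s : ℝ × ℝ} {C : Set (ℝ × ℝ)} (hC : C.Nonempty) {x : ℝ}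
    (h : ∀ t ∈ C, x + W s ≤ W t + lam * dL1 t s) : x ≤ Sl lam W s C := by
  unfold Sl
  have : x + W s ≤ sInf ((fun t => W t + lam * dL1 t s) '' C) := by
    apply le_csInf (hC.image _)
    rintro _ ⟨u, hu, rfl⟩
    exact h u hu
  linarith

lemma left_mem_Boks (a b : ℝ × ℝ) : a ∈ Boks a b := ⟨Set.left_mem_uIcc, Set.left_mem_uIcc⟩
lemma right_mem_Boks (a b : ℝ × ℝ) : b ∈ Boks a b := ⟨Set.right_mem_uIcc, Set.right_mem_uIcc⟩
lemma Boks_comm (a b : ℝ × ℝ) : Boks a b = Boks b a := by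
  unfold Boks; rw [Set.uIcc_comm a.1, Set.uIcc_comm a.2]
lemma Boks_compact (a b : ℝ × ℝ) : IsCompact (Boks a b) := by
  have : Boks a b = Set.uIcc a.1 b.1 ×ˢ Set.uIcc a.2 b.2 := rfl
  rw [this]
  exact isCompact_uIcc.prod isCompact_uIcc

lemma near_uIcc {a b a' b' x : ℝ} (hx : x ∈ Set.uIcc a' b') :
    ∃ y ∈ Set.uIcc a b, |y - x| ≤ |a - a'| + |b - b'| := by
  rcases Set.mem_uIcc.1 hx with h | h
  all_goals
    refine ⟨max (min a b) (min x (max a b)), ?_, ?_⟩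
    · rw [Set.uIcc]
      refine ⟨le_max_left _ _, max_le (by simp) (min_le_right _ _)⟩
    · grind

/-- Points of one rectangle are close to points of a nearby rectangle. -/
lemma near_Boks {a b a' b' p : ℝ × ℝ} (hp : p ∈ Boks a' b') :
    ∃ r ∈ Boks a b, dL1 r p ≤ dL1 a a' + dL1 b b' := by
  obtain ⟨y1, h1, e1⟩ := near_uIcc (a := a.1) (b := b.1) hp.1
  obtain ⟨y2, h2, e2⟩ := near_uIcc (a := a.2) (b := b.2) hp.2
  refine ⟨(y1, y2), ⟨h1, h2⟩, ?_⟩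
  unfold dL1
  simp only
  linarith

/-! ### Potential: generic facts -/

/-- The properties of a work function whose last request is `r(p)`. -/
structure IsWork (W : ℝ × ℝ → ℝ) (O p : ℝ × ℝ) : Prop where
  lip : ∀ s t, W s ≤ W t + dL1 t s
  ge : ∀ s, dL1 O s ≤ W s
  rep : ∀ s, ∃ q ∈ req p, W s = W q + dL1 q s

section generic

variable {lam α : ℝ} {W : ℝ × ℝ → ℝ} {O p : ℝ × ℝ}

lemma obj_nonneg (h0 : 0 < lam) (hα : 0 < α) (hb : α * (1 + lam) ≤ 1 - lam) (hW : IsWork W O p)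
    {S : ℝ} (s1 s2 s3 : ℝ × ℝ) (e1 : S ≤ W s1 + lam * dL1 s1 s3 - W s3)
    (e2 : S ≤ W s2 + lam * dL1 s2 s3 - W s3) : 0 ≤ Hf lam W s1 s2 - α * S := by
  unfold Hf
  have g1 := hW.ge s1
  have g2 := hW.ge s2
  have g3 := hW.ge s3
  have n1 := dL1_nonneg O s1
  have n2 := dL1_nonneg O s2
  have n3 := dL1_nonneg O s3
  have t12 := dL1_tri s1 O s2
  have t13 := dL1_tri s1 O s3
  have t23 := dL1_tri s2 O s3
  rw [dL1_comm s1 O] at t12 t13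
  rw [dL1_comm s2 O] at t23
  have hS : α * S ≤ α * ((W s1 + W s2) / 2 + lam / 2 * (dL1 s1 s3 + dL1 s2 s3) - W s3) :=
    mul_le_mul_of_nonneg_left (by linarith) hα.le
  have k0 : lam * dL1 s1 s2 ≤ lam * (dL1 O s1 + dL1 O s2) := mul_le_mul_of_nonneg_left t12 h0.le
  have k1 : α * lam * dL1 s1 s3 ≤ α * lam * (dL1 O s1 + dL1 O s3) :=
    mul_le_mul_of_nonneg_left t13 (by positivity)
  have k2 : α * lam * dL1 s2 s3 ≤ α * lam * (dL1 O s2 + dL1 O s3) :=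
    mul_le_mul_of_nonneg_left t23 (by positivity)
  have hl1 : lam < 1 := by nlinarith
  have hα1 : α < 1 := by nlinarith
  have k3 : (1 - α) * dL1 O s1 ≤ (1 - α) * W s1 := mul_le_mul_of_nonneg_left g1 (by linarith)
  have k4 : (1 - α) * dL1 O s2 ≤ (1 - α) * W s2 := mul_le_mul_of_nonneg_left g2 (by linarith)
  have k5 : α * dL1 O s3 ≤ α * W s3 := mul_le_mul_of_nonneg_left g3 hα.le
  have k6 : 0 ≤ (1 - lam - α * (1 + lam)) * (dL1 O s1 + dL1 O s2) :=
    mul_nonneg (by linarith) (by linarith)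
  have k7 : 0 ≤ α * (1 - lam) * dL1 O s3 := by
    have : 0 ≤ 1 - lam := by linarith
    positivity
  nlinarith

lemma Ff_nonneg (h0 : 0 < lam) (hα : 0 < α) (hb : α * (1 + lam) ≤ 1 - lam) (hW : IsWork W O p)
    (s1 s2 s3 : ℝ × ℝ) : 0 ≤ Ff lam α W s1 s2 s3 :=
  obj_nonneg h0 hα hb hW s1 s2 s3 (Sl_le h0.le hW.ge (by simp)) (Sl_le h0.le hW.ge (by simp))

lemma Gf_nonneg (h0 : 0 < lam) (hα : 0 < α) (hb : α * (1 + lam) ≤ 1 - lam) (hW : IsWork W O p)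
    (s1 s2 s3 : ℝ × ℝ) : 0 ≤ Gf lam α W s1 s2 s3 :=
  obj_nonneg h0 hα hb hW s1 s2 s3 (Sl_le h0.le hW.ge (left_mem_Boks _ _))
    (Sl_le h0.le hW.ge (right_mem_Boks _ _))

lemma infF_le (h0 : 0 < lam) (hα : 0 < α) (hb : α * (1 + lam) ≤ 1 - lam) (hW : IsWork W O p)
    (s1 s2 s3 : ℝ × ℝ) : infF lam α W ≤ Ff lam α W s1 s2 s3 := by
  apply csInf_le
  · refine ⟨0, ?_⟩
    rintro _ ⟨q, rfl⟩
    exact Ff_nonneg h0 hα hb hW _ _ _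
  · exact ⟨(s1, s2, s3), rfl⟩

lemma infG_le (h0 : 0 < lam) (hα : 0 < α) (hb : α * (1 + lam) ≤ 1 - lam) (hW : IsWork W O p)
    (s1 s2 s3 : ℝ × ℝ) : infG lam α W ≤ Gf lam α W s1 s2 s3 := by
  apply csInf_le
  · refine ⟨0, ?_⟩
    rintro _ ⟨q, rfl⟩
    exact Gf_nonneg h0 hα hb hW _ _ _
  · exact ⟨(s1, s2, s3), rfl⟩

lemma infF_le_H (h0 : 0 < lam) (hα : 0 < α) (hb : α * (1 + lam) ≤ 1 - lam) (hW : IsWork W O p)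
    (s1 s2 : ℝ × ℝ) : infF lam α W ≤ Hf lam W s1 s2 := by
  obtain ⟨w, hw⟩ : ∃ w, ∀ t ∈ ({s1, s2} : Set (ℝ × ℝ)), W w ≤ W t := by
    rcases le_total (W s1) (W s2) with h | h
    · exact ⟨s1, by simp [h]⟩
    · exact ⟨s2, by simp [h]⟩
  have h1 := infF_le h0 hα hb hW s1 s2 w
  have h2 : 0 ≤ Sl lam W w {s1, s2} := by
    apply le_Sl (by simp)
    intro t ht
    have := hw t ht
    have := mul_nonneg h0.le (dL1_nonneg t w)
    linarith
  have := mul_nonneg hα.le h2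
  unfold Ff at h1
  linarith

lemma infG_le_H (h0 : 0 < lam) (hα : 0 < α) (hb : α * (1 + lam) ≤ 1 - lam) (hW : IsWork W O p)
    (s1 s2 : ℝ × ℝ) : infG lam α W ≤ Hf lam W s1 s2 := by
  obtain ⟨w, -, hw⟩ := (Boks_compact s1 s2).exists_isMinOn ⟨s1, left_mem_Boks _ _⟩
    (continuous_of_lip hW.lip).continuousOn
  have h1 := infG_le h0 hα hb hW s1 s2 w
  have h2 : 0 ≤ Sl lam W w (Boks s1 s2) := by
    apply le_Sl ⟨s1, left_mem_Boks _ _⟩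
    intro t ht
    have : W w ≤ W t := hw ht
    have := mul_nonneg h0.le (dL1_nonneg t w)
    linarith
  have := mul_nonneg hα.le h2
  unfold Gf at h1
  linarith

lemma Hf_move (h0 : 0 < lam) {s1 s2 q1 q2 : ℝ × ℝ}
    (e1 : W s1 = W q1 + dL1 q1 s1) (e2 : W s2 = W q2 + dL1 q2 s2) :
    Hf lam W q1 q2 ≤ Hf lam W s1 s2 - (1 - lam) / 2 * (dL1 q1 s1 + dL1 q2 s2) := by
  unfold Hf
  have a := dL1_tri s1 q1 s2
  have b := dL1_tri q1 q2 s2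
  rw [dL1_comm s1 q1] at a
  have : lam * dL1 s1 s2 ≤ lam * (dL1 q1 s1 + dL1 q1 q2 + dL1 q2 s2) :=
    mul_le_mul_of_nonneg_left (by linarith) h0.le
  linarith

lemma Sl_move (h0 : 0 < lam) (hW : IsWork W O p) {s3 q3 : ℝ × ℝ} {C C' : Set (ℝ × ℝ)} {e : ℝ}
    (e3 : W s3 = W q3 + dL1 q3 s3) (hC : C'.Nonempty)
    (h : ∀ u ∈ C', ∃ r ∈ C, dL1 r u ≤ e) :
    Sl lam W s3 C - (1 + lam) * e + (1 - lam) * dL1 q3 s3 ≤ Sl lam W q3 C' := by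
  apply le_Sl hC
  intro u hu
  obtain ⟨r, hr, hd⟩ := h u hu
  have a := Sl_le (s := s3) h0.le hW.ge hr
  have b := hW.lip r u
  rw [dL1_comm] at b
  have t1 := dL1_tri r u s3
  have t2 := dL1_tri u q3 s3
  have : lam * dL1 r s3 ≤ lam * (e + dL1 u q3 + dL1 q3 s3) :=
    mul_le_mul_of_nonneg_left (by linarith) h0.le
  nlinarith

lemma Ff_move (h0 : 0 < lam) (hl : lam < 1) (hα : 0 < α) (hW : IsWork W O p)
    {s1 s2 s3 q1 q2 q3 : ℝ × ℝ} (e1 : W s1 = W q1 + dL1 q1 s1) (e2 : W s2 = W q2 + dL1 q2 s2)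
    (e3 : W s3 = W q3 + dL1 q3 s3) :
    Ff lam α W q1 q2 q3 ≤ Ff lam α W s1 s2 s3 - ((1 - lam) / 2 - 2 * α) * (dL1 q1 s1 + dL1 q2 s2)
      - α * (1 - lam) * dL1 q3 s3 := by
  have a := Hf_move h0 e1 e2
  have n1 := dL1_nonneg q1 s1
  have n2 := dL1_nonneg q2 s2
  have b := Sl_move (C := {s1, s2}) (C' := {q1, q2}) (e := dL1 q1 s1 + dL1 q2 s2) h0 hW e3
    (by simp) (by
      intro u hu
      rcases hu with rfl | rfl
      · exact ⟨s1, by simp, by rw [dL1_comm]; linarith⟩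
      · exact ⟨s2, by simp, by rw [dL1_comm]; linarith⟩)
  have c := mul_le_mul_of_nonneg_left b hα.le
  have d : 0 ≤ α * (1 - lam) * (dL1 q1 s1 + dL1 q2 s2) :=
    mul_nonneg (mul_nonneg hα.le (by linarith)) (by linarith)
  unfold Ff
  nlinarith

lemma Gf_move (h0 : 0 < lam) (hl : lam < 1) (hα : 0 < α) (hW : IsWork W O p)
    {s1 s2 s3 q1 q2 q3 : ℝ × ℝ} (e1 : W s1 = W q1 + dL1 q1 s1) (e2 : W s2 = W q2 + dL1 q2 s2)
    (e3 : W s3 = W q3 + dL1 q3 s3) :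
    Gf lam α W q1 q2 q3 ≤ Gf lam α W s1 s2 s3 - ((1 - lam) / 2 - 2 * α) * (dL1 q1 s1 + dL1 q2 s2)
      - α * (1 - lam) * dL1 q3 s3 := by
  have a := Hf_move h0 e1 e2
  have n1 := dL1_nonneg q1 s1
  have n2 := dL1_nonneg q2 s2
  have b := Sl_move (C := Boks s1 s2) (C' := Boks q1 q2) (e := dL1 q1 s1 + dL1 q2 s2) h0 hW e3
    ⟨q1, left_mem_Boks _ _⟩ (by
      intro u hu
      rw [dL1_comm q1, dL1_comm q2]
      exact near_Boks hu)
  have c := mul_le_mul_of_nonneg_left b hα.le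
  have d : 0 ≤ α * (1 - lam) * (dL1 q1 s1 + dL1 q2 s2) :=
    mul_nonneg (mul_nonneg hα.le (by linarith)) (by linarith)
  unfold Gf
  nlinarith

end generic

/-! ### Two consecutive work functions -/

/-- `W` is the work function after `r(x,y)`, `V` after the further request `r(X,Y)`. -/
structure Pair (W V : ℝ × ℝ → ℝ) (O : ℝ × ℝ) (x y X Y : ℝ) : Prop where
  w : IsWork W O (x, y)
  v : IsWork V O (X, Y)
  eq : ∀ t ∈ req (X, Y), V t = W t
  le : ∀ s, W s ≤ V s
  hxy : |y - Y| ≤ |x - X|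

section pair

variable {lam α : ℝ} {W V : ℝ × ℝ → ℝ} {O : ℝ × ℝ} {x y X Y : ℝ}

lemma exists_near (hP : Pair W V O x y X Y) {q : ℝ × ℝ} (hq : q ∈ req (x, y)) :
    ∃ t ∈ req (X, Y), dL1 t q ≤ |x - X| := by
  have := hP.hxy
  rcases hq with h | h
  · refine ⟨(X, q.2), Or.inl rfl, ?_⟩
    simp only [dL1, sub_self, abs_zero, add_zero, h]
    rw [abs_sub_comm]
  · refine ⟨(q.1, Y), Or.inr rfl, ?_⟩
    simp only [dL1, sub_self, abs_zero, zero_add, h]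
    rw [abs_sub_comm]; exact this

lemma Sl_le_dx (h0 : 0 < lam) (hl : lam < 1) (hP : Pair W V O x y X Y) (s : ℝ × ℝ) :
    Sl lam W s (req (X, Y)) ≤ 2 * |x - X| := by
  obtain ⟨q, hq, e⟩ := hP.w.rep s
  obtain ⟨t, ht, hd⟩ := exists_near hP hq
  have a := Sl_le (s := s) h0.le hP.w.ge ht
  have b := hP.w.lip t q
  rw [dL1_comm] at b
  have c := dL1_tri t q s
  have n := dL1_nonneg q s
  have n' := abs_nonneg (x - X)
  have : lam * dL1 t s ≤ lam * (|x - X| + dL1 q s) :=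
    mul_le_mul_of_nonneg_left (by linarith) h0.le
  nlinarith

lemma V_le (hP : Pair W V O x y X Y) (s : ℝ × ℝ) : V s ≤ W s + 2 * |x - X| := by
  obtain ⟨q, hq, e⟩ := hP.w.rep s
  obtain ⟨t, ht, hd⟩ := exists_near hP hq
  have a := hP.v.lip s t
  rw [hP.eq t ht] at a
  have b := hP.w.lip t q
  rw [dL1_comm] at b
  have c := dL1_tri t q s
  linarith

lemma loss_of (h0 : 0 < lam) (hP : Pair W V O x y X Y) {u3 : ℝ × ℝ} (hu3 : u3 ∈ req (X, Y))
    {C : Set (ℝ × ℝ)} (hC : C.Nonempty) {L : ℝ}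
    (h : ∀ p ∈ C, ∃ r ∈ C, V r + lam * dL1 r u3 ≤ W p + lam * dL1 p u3 + L) :
    Sl lam V u3 C ≤ Sl lam W u3 C + L := by
  have : Sl lam V u3 C - L ≤ Sl lam W u3 C := by
    apply le_Sl hC
    intro p hp
    obtain ⟨r, hr, e⟩ := h p hp
    have := Sl_le (s := u3) h0.le hP.v.ge hr
    rw [hP.eq u3 hu3] at this
    linarith
  linarith

lemma step_cost (h0 : 0 < lam) (hl : lam < 1) (hP : Pair W V O x y X Y) {r p : ℝ × ℝ}
    (u3 : ℝ × ℝ) (hr : r ∈ req (X, Y)) {e : ℝ} (hd : dL1 r p ≤ e) :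
    V r + lam * dL1 r u3 ≤ W p + lam * dL1 p u3 + 2 * e := by
  have a := hP.w.lip r p
  rw [dL1_comm] at a
  rw [hP.eq r hr]
  have n := dL1_nonneg r p
  have : lam * dL1 r u3 ≤ lam * (dL1 r p + dL1 p u3) :=
    mul_le_mul_of_nonneg_left (dL1_tri _ _ _) h0.le
  nlinarith

lemma same_line (h0 : 0 < lam) (hP : Pair W V O x y X Y) {u1 u2 u3 : ℝ × ℝ}
    (hu3 : u3 ∈ req (X, Y)) (h : (u1.1 = X ∧ u2.1 = X) ∨ (u1.2 = Y ∧ u2.2 = Y)) :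
    Sl lam V u3 (Boks u1 u2) ≤ Sl lam W u3 (Boks u1 u2) := by
  have := loss_of (L := 0) (C := Boks u1 u2) h0 hP hu3 ⟨u1, left_mem_Boks _ _⟩ (by
    intro p hp
    refine ⟨p, hp, ?_⟩
    have : p ∈ req (X, Y) := by
      rcases h with ⟨h1, h2⟩ | ⟨h1, h2⟩
      · left
        have := hp.1
        rw [h1, h2] at this
        simpa using this
      · right
        have := hp.2
        rw [h1, h2] at this
        simpa using this
    rw [hP.eq p this]; linarith)
  linarith

lemma uIcc_abs_le {a b z : ℝ} (h : z ∈ Set.uIcc a b) : |b - z| ≤ |a - b| := by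
  rcases Set.mem_uIcc.1 h with h | h <;> grind

/-- Basic losses when `u` is on the vertical line and `v` on the horizontal line. -/
lemma diff_basic (h0 : 0 < lam) (hl : lam < 1) (hP : Pair W V O x y X Y) {u v u3 : ℝ × ℝ}
    (hu3 : u3 ∈ req (X, Y)) (hu : u.1 = X) (hv : v.2 = Y) :
    Sl lam V u3 (Boks u v) ≤ Sl lam W u3 (Boks u v) + 2 * |x - X| ∧
    Sl lam V u3 (Boks u v) ≤ Sl lam W u3 (Boks u v) + 2 * |u.2 - Y| ∧
    Sl lam V u3 (Boks u v) ≤ Sl lam W u3 (Boks u v) + 2 * |v.1 - X| := by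
  refine ⟨?_, ?_, ?_⟩ <;> apply loss_of h0 hP hu3 ⟨u, left_mem_Boks _ _⟩ <;> intro p hp
  · exact ⟨p, hp, by linarith [V_le hP p]⟩
  · refine ⟨(p.1, Y), ⟨hp.1, by rw [← hv]; exact Set.right_mem_uIcc⟩,
      step_cost (r := (p.1, Y)) h0 hl hP u3 (Or.inr rfl) ?_⟩
    have := uIcc_abs_le hp.2
    rw [hv] at this
    simpa [dL1] using this
  · refine ⟨(X, p.2), ⟨by rw [← hu]; exact Set.left_mem_uIcc, hp.2⟩,
      step_cost (r := (X, p.2)) h0 hl hP u3 (Or.inl rfl) ?_⟩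
    have := hp.1
    rw [Set.uIcc_comm] at this
    have := uIcc_abs_le this
    rw [hu] at this
    simpa [dL1] using this

/-- A point of the vertical line of `r(X,Y)` close to `r(x,y)`. -/
lemma vert_near {u q : ℝ × ℝ} (hu : u.1 = X) (hq : q ∈ req (x, y)) :
    |x - X| ≤ dL1 q u ∨ |u.2 - y| ≤ dL1 q u := by
  unfold dL1
  rcases hq with h | h <;> simp only at h
  · left; rw [h, hu]; linarith [abs_nonneg (q.2 - u.2)]
  · right; rw [h, abs_sub_comm u.2]; linarith [abs_nonneg (q.1 - u.1)]

lemma horiz_near {u q : ℝ × ℝ} (hu : u.2 = Y) (hq : q ∈ req (x, y)) :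
    |y - Y| ≤ dL1 q u ∨ |u.1 - x| ≤ dL1 q u := by
  unfold dL1
  rcases hq with h | h <;> simp only at h
  · right; rw [h, abs_sub_comm u.1]; linarith [abs_nonneg (q.2 - u.2)]
  · left; rw [h, hu]; linarith [abs_nonneg (q.1 - u.1)]

lemma diff_loss1 (h0 : 0 < lam) (hl : lam < 1) (hP : Pair W V O x y X Y) {u v u3 q : ℝ × ℝ}
    (hu3 : u3 ∈ req (X, Y)) (hu : u.1 = X) (hv : v.2 = Y) (hq : q ∈ req (x, y)) :
    Sl lam V u3 (Boks u v) ≤ Sl lam W u3 (Boks u v) + 2 * (dL1 q u + |y - Y|) := by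
  obtain ⟨a, b, -⟩ := diff_basic h0 hl hP hu3 hu hv
  have n := abs_nonneg (y - Y)
  rcases vert_near hu hq with h | h
  · linarith
  · have := abs_sub_le u.2 y Y
    linarith

lemma loss1 (h0 : 0 < lam) (hl : lam < 1) (hP : Pair W V O x y X Y) {u1 u2 u3 q1 q2 : ℝ × ℝ}
    (hu1 : u1 ∈ req (X, Y)) (hu2 : u2 ∈ req (X, Y)) (hu3 : u3 ∈ req (X, Y))
    (hq1 : q1 ∈ req (x, y)) (hq2 : q2 ∈ req (x, y)) :
    Sl lam V u3 (Boks u1 u2) ≤ Sl lam W u3 (Boks u1 u2)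
      + 2 * (dL1 q1 u1 + dL1 q2 u2 + |y - Y|) := by
  have n := abs_nonneg (y - Y)
  have n1 := dL1_nonneg q1 u1
  have n2 := dL1_nonneg q2 u2
  rcases hu1 with h1 | h1 <;> rcases hu2 with h2 | h2
  · linarith [same_line (lam := lam) h0 hP hu3 (Or.inl ⟨h1, h2⟩)]
  · linarith [diff_loss1 h0 hl hP hu3 h1 h2 hq1]
  · rw [Boks_comm]
    linarith [diff_loss1 h0 hl hP hu3 h2 h1 hq2]
  · linarith [same_line (lam := lam) h0 hP hu3 (Or.inr ⟨h1, h2⟩)]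

/-- The nearest request point (in the `λ`-slack sense) is close to the old request. -/
lemma exists_t (h0 : 0 < lam) (hP : Pair W V O x y X Y) {D : ℝ}
    (hD : ∀ s, Sl lam W s (req (X, Y)) ≤ D) (p : ℝ × ℝ) :
    ∃ t ∈ req (X, Y), W t + lam * dL1 t p ≤ W p + D ∧
      ∃ q ∈ req (x, y), (1 - lam) * dL1 q t ≤ D := by
  have key : ∀ s, ∃ t ∈ req (X, Y), (∀ t' ∈ req (X, Y), W t + lam * dL1 t s ≤ W t' + lam * dL1 t' s)
      ∧ W t + lam * dL1 t s ≤ W s + D := by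
    intro s
    obtain ⟨t, ht, hm⟩ := exists_min_req hP.w.lip hP.w.ge h0.le (X, Y) s
    refine ⟨t, ht, hm, ?_⟩
    have : W t + lam * dL1 t s - W s ≤ Sl lam W s (req (X, Y)) := by
      apply le_Sl (req_nonempty _)
      intro t' ht'
      linarith [hm t' ht']
    linarith [hD s]
  obtain ⟨t, ht, hm, he⟩ := key p
  refine ⟨t, ht, he, ?_⟩
  obtain ⟨q, hq, e⟩ := hP.w.rep t
  refine ⟨q, hq, ?_⟩
  obtain ⟨t', ht', -, he'⟩ := key q
  have a := hm t' ht'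
  have t1 := dL1_tri t' q p
  have t2 := dL1_tri q t p
  have : lam * dL1 t' p ≤ lam * (dL1 t' q + dL1 q t + dL1 t p) :=
    mul_le_mul_of_nonneg_left (by linarith) h0.le
  linarith

lemma diff_loss2 (h0 : 0 < lam) (hl : lam < 1) (hP : Pair W V O x y X Y) {D K : ℝ}
    (hK : K * (1 - lam) = 1) (hD0 : 0 ≤ D)
    (hD : ∀ s, Sl lam W s (req (X, Y)) ≤ D) {u v u3 q r : ℝ × ℝ}
    (hu3 : u3 ∈ req (X, Y)) (hu : u.1 = X) (hv : v.2 = Y) (hq : q ∈ req (x, y))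
    (hr : r ∈ req (x, y)) :
    Sl lam V u3 (Boks u v) ≤ Sl lam W u3 (Boks u v)
      + (2 * K + 2) * (dL1 q u + dL1 r v + D) := by
  obtain ⟨b1, b2, b3⟩ := diff_basic h0 hl hP hu3 hu hv
  have n1 := dL1_nonneg q u
  have n2 := dL1_nonneg r v
  have hK1 : 1 ≤ K := by nlinarith
  have hKe : K * D ≤ K * (dL1 q u + dL1 r v + D) := mul_le_mul_of_nonneg_left (by linarith) (by linarith)
  have hKe' : 0 ≤ (K - 1) * (dL1 q u + dL1 r v + D) := mul_nonneg (by linarith) (by linarith)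
  by_cases c1 : |x - X| ≤ (K + 1) * (dL1 q u + dL1 r v + D)
  · linarith
  by_cases c2 : |u.2 - Y| ≤ (K + 1) * (dL1 q u + dL1 r v + D)
  · linarith
  by_cases c3 : |v.1 - X| ≤ (K + 1) * (dL1 q u + dL1 r v + D)
  · linarith
  push Not at c1 c2 c3
  have f1 : |u.2 - y| ≤ dL1 q u := by
    rcases vert_near hu hq with h | h
    · linarith
    · exact h
  have f2 : K * (dL1 q u + dL1 r v + D) < |y - Y| := by
    have := abs_sub_le u.2 y Y
    linarith
  have f3 : |v.1 - x| ≤ dL1 r v := by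
    rcases horiz_near hv hr with h | h
    · linarith
    · exact h
  apply loss_of h0 hP hu3 ⟨u, left_mem_Boks _ _⟩
  intro p hp
  obtain ⟨t, ht, he, q', hq', hd⟩ := exists_t h0 hP hD p
  have hd' : dL1 q' t ≤ K * D := by
    have := mul_le_mul_of_nonneg_left hd (by linarith : (0:ℝ) ≤ K)
    rw [← mul_assoc, hK, one_mul] at this
    exact this
  have fin : ∀ w ∈ req (X, Y), dL1 w t ≤ K * D + dL1 q u + dL1 r v →
      V w + lam * dL1 w u3 ≤ W p + lam * dL1 p u3
        + (2 * K + 2) * (dL1 q u + dL1 r v + D) := by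
    intro w hw hwt
    have a := step_cost h0 hl hP u3 hw hwt
    have : lam * dL1 t u3 ≤ lam * (dL1 t p + dL1 p u3) :=
      mul_le_mul_of_nonneg_left (dL1_tri _ _ _) h0.le
    nlinarith
  rcases ht with ht | ht
  · refine ⟨u, left_mem_Boks _ _, fin u (Or.inl hu) ?_⟩
    have g : |t.2 - y| ≤ dL1 q' t := by
      rcases vert_near ht hq' with h | h
      · linarith
      · exact h
    have := abs_sub_le u.2 y t.2
    rw [abs_sub_comm y] at this
    have e : dL1 u t = |u.2 - t.2| := by
      simp only at ht
      unfold dL1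
      rw [hu, ht, sub_self, abs_zero, zero_add]
    linarith
  · refine ⟨v, right_mem_Boks _ _, fin v (Or.inr hv) ?_⟩
    have g : |t.1 - x| ≤ dL1 q' t := by
      rcases horiz_near ht hq' with h | h
      · linarith
      · exact h
    have := abs_sub_le v.1 x t.1
    rw [abs_sub_comm x] at this
    have e : dL1 v t = |v.1 - t.1| := by
      simp only at ht
      unfold dL1
      rw [hv, ht, sub_self, abs_zero, add_zero]
    linarith

lemma loss2 (h0 : 0 < lam) (hl : lam < 1) (hP : Pair W V O x y X Y) {D K : ℝ}
    (hK : K * (1 - lam) = 1) (hD0 : 0 ≤ D)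
    (hD : ∀ s, Sl lam W s (req (X, Y)) ≤ D) {u1 u2 u3 q1 q2 : ℝ × ℝ}
    (hu1 : u1 ∈ req (X, Y)) (hu2 : u2 ∈ req (X, Y)) (hu3 : u3 ∈ req (X, Y))
    (hq1 : q1 ∈ req (x, y)) (hq2 : q2 ∈ req (x, y)) :
    Sl lam V u3 (Boks u1 u2) ≤ Sl lam W u3 (Boks u1 u2)
      + (2 * K + 2) * (dL1 q1 u1 + dL1 q2 u2 + D) := by
  have n1 := dL1_nonneg q1 u1
  have n2 := dL1_nonneg q2 u2
  have hK1 : 1 ≤ K := by nlinarith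
  have n : 0 ≤ (2 * K + 2) * (dL1 q1 u1 + dL1 q2 u2 + D) :=
    mul_nonneg (by linarith) (by linarith)
  rcases hu1 with h1 | h1 <;> rcases hu2 with h2 | h2
  · linarith [same_line (lam := lam) h0 hP hu3 (Or.inl ⟨h1, h2⟩)]
  · exact diff_loss2 h0 hl hP hK hD0 hD hu3 h1 h2 hq1 hq2
  · rw [Boks_comm, add_comm (dL1 q1 u1)]
    exact diff_loss2 h0 hl hP hK hD0 hD hu3 h2 h1 hq2 hq1
  · linarith [same_line (lam := lam) h0 hP hu3 (Or.inr ⟨h1, h2⟩)]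

/-! ### The three estimates -/

lemma Ff_eq (hP : Pair W V O x y X Y) {t1 t2 t3 : ℝ × ℝ} (h1 : t1 ∈ req (X, Y))
    (h2 : t2 ∈ req (X, Y)) (h3 : t3 ∈ req (X, Y)) :
    Ff lam α V t1 t2 t3 = Ff lam α W t1 t2 t3 := by
  have : (fun t => V t + lam * dL1 t t3) '' {t1, t2} = (fun t => W t + lam * dL1 t t3) '' {t1, t2} := by
    simp only [Set.image_pair, hP.eq t1 h1, hP.eq t2 h2]
  unfold Ff Hf Sl
  rw [this, hP.eq t1 h1, hP.eq t2 h2, hP.eq t3 h3]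

lemma le_infF (h0 : 0 < lam) (hl : lam < 1) (hα : 0 < α) (hα2 : 16 * α = (1 - lam) ^ 2)
    (hP : Pair W V O x y X Y) {c : ℝ}
    (h : ∀ t1 ∈ req (X, Y), ∀ t2 ∈ req (X, Y), ∀ t3 ∈ req (X, Y), c ≤ Ff lam α W t1 t2 t3) :
    c ≤ infF lam α V := by
  apply le_csInf (Set.range_nonempty _)
  rintro _ ⟨⟨s1, s2, s3⟩, rfl⟩
  obtain ⟨t1, h1, e1⟩ := hP.v.rep s1
  obtain ⟨t2, h2, e2⟩ := hP.v.rep s2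
  obtain ⟨t3, h3, e3⟩ := hP.v.rep s3
  have a := h t1 h1 t2 h2 t3 h3
  rw [← Ff_eq hP h1 h2 h3] at a
  have b := Ff_move h0 hl hα hP.v e1 e2 e3
  have c1 : 0 ≤ ((1 - lam) / 2 - 2 * α) * (dL1 t1 s1 + dL1 t2 s2) :=
    mul_nonneg (by nlinarith) (add_nonneg (dL1_nonneg _ _) (dL1_nonneg _ _))
  have c2 : 0 ≤ α * (1 - lam) * dL1 t3 s3 :=
    mul_nonneg (mul_nonneg hα.le (by linarith)) (dL1_nonneg _ _)
  simp only
  linarith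

lemma le_infG (h0 : 0 < lam) (hl : lam < 1) (hα : 0 < α) (hα2 : 16 * α = (1 - lam) ^ 2)
    (hP : Pair W V O x y X Y) {c : ℝ}
    (h : ∀ t1 ∈ req (X, Y), ∀ t2 ∈ req (X, Y), ∀ t3 ∈ req (X, Y), c ≤ Gf lam α V t1 t2 t3) :
    c ≤ infG lam α V := by
  apply le_csInf (Set.range_nonempty _)
  rintro _ ⟨⟨s1, s2, s3⟩, rfl⟩
  obtain ⟨t1, h1, e1⟩ := hP.v.rep s1
  obtain ⟨t2, h2, e2⟩ := hP.v.rep s2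
  obtain ⟨t3, h3, e3⟩ := hP.v.rep s3
  have a := h t1 h1 t2 h2 t3 h3
  have b := Gf_move h0 hl hα hP.v e1 e2 e3
  have c1 : 0 ≤ ((1 - lam) / 2 - 2 * α) * (dL1 t1 s1 + dL1 t2 s2) :=
    mul_nonneg (by nlinarith) (add_nonneg (dL1_nonneg _ _) (dL1_nonneg _ _))
  have c2 : 0 ≤ α * (1 - lam) * dL1 t3 s3 :=
    mul_nonneg (mul_nonneg hα.le (by linarith)) (dL1_nonneg _ _)
  simp only
  linarith

lemma anchor (hP : Pair W V O x y X Y) {t q : ℝ × ℝ} (ht : t ∈ req (X, Y)) (hq : q ∈ req (x, y))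
    (h : dL1 q t < |y - Y|) : dL1 t (x, Y) ≤ dL1 q t ∨ dL1 t (X, y) ≤ dL1 q t := by
  have := hP.hxy
  rcases ht with ht | ht
  · right
    rcases vert_near ht hq with g | g
    · linarith
    · simp only at ht
      have e : dL1 t (X, y) = |t.2 - y| := by simp [dL1, ht]
      rw [e]; exact g
  · left
    rcases horiz_near ht hq with g | g
    · linarith
    · simp only at ht
      have e : dL1 t (x, Y) = |t.1 - x| := by simp [dL1, ht]
      rw [e]; exact g

lemma caseI (h0 : 0 < lam) (hl : lam < 1) (hα : 0 < α) (hα2 : 16 * α = (1 - lam) ^ 2)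
    (hb : α * (1 + lam) ≤ 1 - lam)
    (hP : Pair W V O x y X Y) {D : ℝ} (hD0 : 0 < D) {s : ℝ × ℝ}
    (hs : D / 2 ≤ Sl lam W s (req (X, Y))) (hy : (1 - lam) / 512 * D < |y - Y|)
    {t1 t2 t3 : ℝ × ℝ} (h1 : t1 ∈ req (X, Y)) (h2 : t2 ∈ req (X, Y)) (h3 : t3 ∈ req (X, Y)) :
    infF lam α W + α * (1 - lam) * ((1 - lam) / 512 * D) ≤ Ff lam α W t1 t2 t3 := by
  by_contra! hc
  have hα16 : α ≤ 1 / 16 := by nlinarith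
  obtain ⟨q1, k1, e1⟩ := hP.w.rep t1
  obtain ⟨q2, k2, e2⟩ := hP.w.rep t2
  obtain ⟨q3, k3, e3⟩ := hP.w.rep t3
  have n1 := dL1_nonneg q1 t1
  have n2 := dL1_nonneg q2 t2
  have n3 := dL1_nonneg q3 t3
  have κ0 : 0 < α * (1 - lam) := mul_pos hα (by linarith)
  have hsum : dL1 q1 t1 + dL1 q2 t2 + dL1 q3 t3 < (1 - lam) / 512 * D := by
    have a := Ff_move h0 hl hα hP.w e1 e2 e3
    have b := infF_le h0 hα hb hP.w q1 q2 q3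
    have c : α * (1 - lam) * (dL1 q1 t1 + dL1 q2 t2)
        ≤ ((1 - lam) / 2 - 2 * α) * (dL1 q1 t1 + dL1 q2 t2) :=
      mul_le_mul_of_nonneg_right (by nlinarith) (by linarith)
    have : α * (1 - lam) * (dL1 q1 t1 + dL1 q2 t2 + dL1 q3 t3)
        < α * (1 - lam) * ((1 - lam) / 512 * D) := by linarith
    exact lt_of_mul_lt_mul_left this κ0.le
  have hε : (1 - lam) / 512 * D ≤ D / 512 := by nlinarith
  set ε := (1 - lam) / 512 * D with hεd
  have hε0 : 0 < ε := mul_pos (by linarith) hD0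
  have hS : D / 4 < Sl lam W t3 {t1, t2} := by
    have a := infF_le h0 hα hb hP.w t1 t2 s
    have b : D / 2 ≤ Sl lam W s {t1, t2} := by
      apply le_Sl (by simp)
      intro t ht
      have : t ∈ req (X, Y) := by
        rcases ht with rfl | rfl
        · exact h1
        · exact h2
      linarith [Sl_le (s := s) h0.le hP.w.ge this]
    unfold Ff at a hc
    have c : α * (D / 2) ≤ α * Sl lam W s {t1, t2} := mul_le_mul_of_nonneg_left b hα.le
    have d : α * (1 - lam) * ε ≤ α * (D / 512) := by
      rw [mul_assoc]
      apply mul_le_mul_of_nonneg_left _ hα.le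
      nlinarith
    have : α * (D / 4) < α * Sl lam W t3 {t1, t2} := by
      have : 0 < α * D := mul_pos hα hD0
      linarith
    exact lt_of_mul_lt_mul_left this hα.le
  have S1 := Sl_le (s := t3) (C := {t1, t2}) (t := t1) h0.le hP.w.ge (by simp)
  have S2 := Sl_le (s := t3) (C := {t1, t2}) (t := t2) h0.le hP.w.ge (by simp)
  set S := Sl lam W t3 {t1, t2} with hSd
  have far : ∀ t, S ≤ W t + lam * dL1 t t3 - W t3 → D / 8 < dL1 t t3 := by
    intro t ht
    have a := hP.w.lip t t3
    rw [dL1_comm] at a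
    have := dL1_nonneg t t3
    nlinarith
  have f1 := far t1 S1
  have f2 := far t2 S2
  have near : ∀ a t t', dL1 t a + dL1 t' a < ε → dL1 t t' < ε := by
    intro a t t' h
    have := dL1_tri t a t'
    rw [dL1_comm a t'] at this
    linarith
  have h12 : dL1 t1 t2 < ε := by
    rcases anchor hP h1 k1 (by linarith) with a1 | a1 <;>
    rcases anchor hP h2 k2 (by linarith) with a2 | a2 <;>
    rcases anchor hP h3 k3 (by linarith) with a3 | a3 <;>
    first
    | (exfalso; linarith [near _ t1 t3 (lt_of_le_of_lt (add_le_add a1 a3) (by linarith))])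
    | (exfalso; linarith [near _ t2 t3 (lt_of_le_of_lt (add_le_add a2 a3) (by linarith))])
    | exact near _ t1 t2 (lt_of_le_of_lt (add_le_add a1 a2) (by linarith))
  have g := infF_le_H h0 hα hb hP.w t1 t3
  have l12 := hP.w.lip t1 t2
  rw [dL1_comm] at l12
  have m12 : lam * dL1 t1 t2 ≤ dL1 t1 t2 := by
    have := dL1_nonneg t1 t2
    nlinarith
  unfold Ff Hf at hc
  unfold Hf at g
  have d : α * (1 - lam) * ε ≤ 1 * ε := mul_le_mul_of_nonneg_right (by nlinarith) hε0.le
  have hαS : α * S ≤ 1 / 16 * S := mul_le_mul_of_nonneg_right hα16 (by linarith)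
  linarith

lemma G0 (h0 : 0 < lam) (hl : lam < 1) (hα : 0 < α) (hα2 : 16 * α = (1 - lam) ^ 2)
    (hb : α * (1 + lam) ≤ 1 - lam)
    (hP : Pair W V O x y X Y) {D K : ℝ} (hK : K * (1 - lam) = 1) (hD0 : 0 ≤ D)
    (hD : ∀ s, Sl lam W s (req (X, Y)) ≤ D)
    {t1 t2 t3 : ℝ × ℝ} (h1 : t1 ∈ req (X, Y)) (h2 : t2 ∈ req (X, Y)) (h3 : t3 ∈ req (X, Y)) :
    infG lam α W - α * (2 * K + 2) * D ≤ Gf lam α V t1 t2 t3 := by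
  obtain ⟨q1, k1, e1⟩ := hP.w.rep t1
  obtain ⟨q2, k2, e2⟩ := hP.w.rep t2
  obtain ⟨q3, k3, e3⟩ := hP.w.rep t3
  have n1 := dL1_nonneg q1 t1
  have n2 := dL1_nonneg q2 t2
  have n3 := dL1_nonneg q3 t3
  have κ0 : 0 < α * (1 - lam) := mul_pos hα (by linarith)
  have a := Gf_move h0 hl hα hP.w e1 e2 e3
  have b := infG_le h0 hα hb hP.w q1 q2 q3
  have c := mul_le_mul_of_nonneg_left (loss2 h0 hl hP hK hD0 hD h1 h2 h3 k1 k2) hα.le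
  have αK : 16 * (α * K) = 1 - lam := by
    have : 16 * (α * K) = (1 - lam) * (K * (1 - lam)) := by linear_combination K * hα2
    rw [this, hK, mul_one]
  have d : α * (2 * K + 2) * (dL1 q1 t1 + dL1 q2 t2)
      ≤ ((1 - lam) / 2 - 2 * α) * (dL1 q1 t1 + dL1 q2 t2) :=
    mul_le_mul_of_nonneg_right (by nlinarith) (by linarith)
  have e : 0 ≤ α * (1 - lam) * dL1 q3 t3 := mul_nonneg κ0.le n3
  unfold Gf at a ⊢
  have hH : Hf lam V t1 t2 = Hf lam W t1 t2 := by
    unfold Hf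
    rw [hP.eq t1 h1, hP.eq t2 h2]
  rw [hH]
  unfold Gf at b
  linarith

/-- Replacing `b` by a point `c` beyond it on an almost horizontal line. -/
lemma swap_H (h0 : 0 < lam) (hl : lam < 1) {S e : ℝ} {a b c : ℝ × ℝ}
    (hS : S ≤ W b + lam * dL1 b c - W c) (he : 0 ≤ e)
    (hd : dL1 a b + dL1 b c ≤ dL1 a c + e) :
    Hf lam W a c ≤ Hf lam W a b - S / 2 + e / 2 := by
  unfold Hf
  have : lam * (dL1 a b + dL1 b c) ≤ lam * (dL1 a c + e) := mul_le_mul_of_nonneg_left hd h0.le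
  nlinarith

lemma flat_add {Y τ : ℝ} {a b c : ℝ × ℝ} (ha : |a.2 - Y| ≤ τ) (hb : |b.2 - Y| ≤ τ)
    (hc : |c.2 - Y| ≤ τ) (h : (a.1 ≤ b.1 ∧ b.1 ≤ c.1) ∨ (c.1 ≤ b.1 ∧ b.1 ≤ a.1)) :
    dL1 a b + dL1 b c ≤ dL1 a c + 4 * τ := by
  have e1 := abs_sub_le a.2 Y b.2
  have e2 := abs_sub_le b.2 Y c.2
  rw [abs_sub_comm Y b.2] at e1
  rw [abs_sub_comm Y c.2] at e2
  have e3 : |a.1 - b.1| + |b.1 - c.1| = |a.1 - c.1| := by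
    rcases h with ⟨h, h'⟩ | ⟨h, h'⟩
    · rw [abs_of_nonpos (by linarith), abs_of_nonpos (by linarith), abs_of_nonpos (by linarith)]
      ring
    · rw [abs_of_nonneg (by linarith), abs_of_nonneg (by linarith), abs_of_nonneg (by linarith)]
      ring
  have := abs_nonneg (a.2 - c.2)
  unfold dL1
  linarith

lemma caseII (h0 : 0 < lam) (hl : lam < 1) (hα : 0 < α) (hα2 : 16 * α = (1 - lam) ^ 2)
    (hb : α * (1 + lam) ≤ 1 - lam)
    (hP : Pair W V O x y X Y) {D : ℝ} (hD0 : 0 < D) (hDx : D ≤ 2 * |x - X|) {s : ℝ × ℝ}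
    (hs : D / 2 ≤ Sl lam W s (req (X, Y))) (hy : |y - Y| ≤ (1 - lam) / 512 * D)
    {t1 t2 t3 : ℝ × ℝ} (h1 : t1 ∈ req (X, Y)) (h2 : t2 ∈ req (X, Y)) (h3 : t3 ∈ req (X, Y)) :
    infG lam α W + α * (1 - lam) / 256 * D ≤ Gf lam α V t1 t2 t3 := by
  have hα16 : α ≤ 1 / 16 := by nlinarith
  obtain ⟨q1, k1, e1⟩ := hP.w.rep t1
  obtain ⟨q2, k2, e2⟩ := hP.w.rep t2
  obtain ⟨q3, k3, e3⟩ := hP.w.rep t3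
  have n1 := dL1_nonneg q1 t1
  have n2 := dL1_nonneg q2 t2
  have n3 := dL1_nonneg q3 t3
  have κ0 : 0 < α * (1 - lam) := mul_pos hα (by linarith)
  have hloss := loss1 h0 hl hP h1 h2 h3 k1 k2
  have hH : Hf lam V t1 t2 = Hf lam W t1 t2 := by
    unfold Hf
    rw [hP.eq t1 h1, hP.eq t2 h2]
  have hαy : α * |y - Y| ≤ α * (1 - lam) / 512 * D := by
    have := mul_le_mul_of_nonneg_left hy hα.le
    linarith
  have hκD : α * (1 - lam) * D ≤ α * D := by
    have : 0 < α * D := mul_pos hα hD0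
    nlinarith
  have hκD' : α * (1 - lam) * D ≤ 1 / 16 * D := by nlinarith
  by_cases hfar : D / 128 ≤ dL1 q1 t1 + dL1 q2 t2 + dL1 q3 t3
  · have a := Gf_move h0 hl hα hP.w e1 e2 e3
    have b := infG_le h0 hα hb hP.w q1 q2 q3
    have c := mul_le_mul_of_nonneg_left hloss hα.le
    have d : (α * (1 - lam) + 2 * α) * (dL1 q1 t1 + dL1 q2 t2)
        ≤ ((1 - lam) / 2 - 2 * α) * (dL1 q1 t1 + dL1 q2 t2) :=
      mul_le_mul_of_nonneg_right (by nlinarith) (by linarith)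
    have f := mul_le_mul_of_nonneg_left hfar κ0.le
    unfold Gf at a ⊢
    unfold Gf at b
    rw [hH]
    linarith
  push Not at hfar
  have hε : (1 - lam) / 512 * D ≤ D / 512 := by nlinarith
  have flat : ∀ t q : ℝ × ℝ, t ∈ req (X, Y) → q ∈ req (x, y) → dL1 q t < D / 128 →
      |t.2 - Y| ≤ D / 64 := by
    intro t q ht hq hd
    rcases ht with ht | ht
    · rcases vert_near ht hq with g | g
      · linarith
      · linarith [abs_sub_le t.2 y Y]
    · simp only at ht
      rw [ht, sub_self, abs_zero]; linarith
  have f1 := flat t1 q1 h1 k1 (by linarith)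
  have f2 := flat t2 q2 h2 k2 (by linarith)
  have f3 := flat t3 q3 h3 k3 (by linarith)
  unfold Gf
  rw [hH]
  by_cases hS : Sl lam V t3 (Boks t1 t2) ≤ D / 4
  · have a := infG_le h0 hα hb hP.w t1 t2 s
    have b : D / 2 - 2 * (D / 64) ≤ Sl lam W s (Boks t1 t2) := by
      apply le_Sl ⟨t1, left_mem_Boks _ _⟩
      intro p hp
      have hm : ((p.1, Y) : ℝ × ℝ) ∈ req (X, Y) := Or.inr rfl
      have hpd : dL1 (p.1, Y) p ≤ D / 64 := by
        have : |Y - p.2| ≤ D / 64 := by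
          have i1 := abs_le.1 f1
          have i2 := abs_le.1 f2
          rw [abs_le]
          rcases Set.mem_uIcc.1 hp.2 with h | h <;> constructor <;> linarith
        simpa [dL1] using this
      have c := Sl_le (s := s) h0.le hP.w.ge hm
      have d := step_cost h0 hl hP s hm hpd
      rw [hP.eq _ hm] at d
      linarith
    have c := mul_le_mul_of_nonneg_left b hα.le
    have d := mul_le_mul_of_nonneg_left hS hα.le
    unfold Gf at a
    have : 0 < α * D := mul_pos hα hD0
    linarith
  push Not at hS
  have S1 := Sl_le (s := t3) h0.le hP.v.ge (left_mem_Boks t1 t2)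
  have S2 := Sl_le (s := t3) h0.le hP.v.ge (right_mem_Boks t1 t2)
  rw [hP.eq _ h3, hP.eq _ h1] at S1
  rw [hP.eq _ h3, hP.eq _ h2] at S2
  have notin : t3.1 ∉ Set.uIcc t1.1 t2.1 := by
    intro hin
    have hm : ((t3.1, t1.2) : ℝ × ℝ) ∈ Boks t1 t2 := ⟨hin, Set.left_mem_uIcc⟩
    have a := Sl_le (s := t3) h0.le hP.v.ge hm
    have b := hP.v.lip (t3.1, t1.2) t3
    rw [dL1_comm] at b
    have c : dL1 (t3.1, t1.2) t3 ≤ D / 32 := by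
      have := abs_sub_le t1.2 Y t3.2
      rw [abs_sub_comm Y] at this
      simp only [dL1, sub_self, abs_zero, zero_add]
      linarith
    have := dL1_nonneg (t3.1, t1.2) t3
    nlinarith
  have hαS : α * Sl lam V t3 (Boks t1 t2) ≤ 1 / 16 * Sl lam V t3 (Boks t1 t2) :=
    mul_le_mul_of_nonneg_right hα16 (by linarith)
  have split : ((t1.1 ≤ t2.1 ∧ t2.1 ≤ t3.1) ∨ (t3.1 ≤ t2.1 ∧ t2.1 ≤ t1.1)) ∨
      ((t2.1 ≤ t1.1 ∧ t1.1 ≤ t3.1) ∨ (t3.1 ≤ t1.1 ∧ t1.1 ≤ t2.1)) := by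
    rw [Set.mem_uIcc] at notin
    grind
  rcases split with h | h
  · have a := swap_H h0 hl S2 (by linarith : 0 ≤ 4 * (D / 64)) (flat_add f1 f2 f3 h)
    have b := infG_le_H h0 hα hb hP.w t1 t3
    linarith
  · have a := swap_H h0 hl S1 (by linarith : 0 ≤ 4 * (D / 64)) (flat_add f2 f1 f3 h)
    have b := infG_le_H h0 hα hb hP.w t2 t3
    have c : Hf lam W t2 t1 = Hf lam W t1 t2 := by
      unfold Hf; rw [dL1_comm]; ring
    linarith

end pair

/-- For every `λ ∈ (0,1)` there are constants `α ∈ (0,1/2)`, `γ ∈ (0,1)` and `c₅ > 0`,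
depending only on `λ`, such that whenever the request `r(x'',y'')` arrives after a sequence
ending in `r(x',y')` (with `Δx ≥ Δy`) and `F_{W_{σ''}}` and `G_{W_{σ''}}` attain their infima
over `M³`, the potential increases by at least `c₅·∇`. -/
theorem potential_increase (lam : ℝ) (h0 : 0 < lam) (h1 : lam < 1) :
    ∃ α : ℝ, 0 < α ∧ α < 1 / 2 ∧ ∃ γ : ℝ, 0 < γ ∧ γ < 1 ∧ ∃ c5 : ℝ, 0 < c5 ∧
      ∀ (O : ℝ × ℝ) (l : List (ℝ × ℝ)) (x' y' x'' y'' : ℝ),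
        |x' - x''| ≥ |y' - y''| →
        (∃ s1 s2 s3 : ℝ × ℝ, ∀ t1 t2 t3 : ℝ × ℝ,
          Ff lam α (WF O (l ++ [(x', y'), (x'', y'')])) s1 s2 s3 ≤
            Ff lam α (WF O (l ++ [(x', y'), (x'', y'')])) t1 t2 t3) →
        (∃ s1 s2 s3 : ℝ × ℝ, ∀ t1 t2 t3 : ℝ × ℝ,
          Gf lam α (WF O (l ++ [(x', y'), (x'', y'')])) s1 s2 s3 ≤
            Gf lam α (WF O (l ++ [(x', y'), (x'', y'')])) t1 t2 t3) →
        Phi lam α γ (WF O (l ++ [(x', y'), (x'', y'')])) -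
            Phi lam α γ (WF O (l ++ [(x', y')])) ≥
          c5 * sSup (Set.range fun s =>
            Sl lam (WF O (l ++ [(x', y')])) s (req (x'', y''))) := by
  
  have hδ : 0 < 1 - lam := by linarith
  obtain ⟨α, hα2⟩ : ∃ α : ℝ, 16 * α = (1 - lam) ^ 2 := ⟨(1 - lam) ^ 2 / 16, by ring⟩
  have hα : 0 < α := by nlinarith [pow_pos hδ 2]
  have hα16 : α ≤ 1 / 16 := by nlinarith
  have hb : α * (1 + lam) ≤ 1 - lam := by nlinarith
  obtain ⟨K, hK⟩ : ∃ K : ℝ, K * (1 - lam) = 1 := ⟨1 / (1 - lam), by field_simp⟩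
  have hK1 : 1 ≤ K := by nlinarith
  obtain ⟨c1, hc1⟩ : ∃ c1 : ℝ, c1 = α * (1 - lam) * ((1 - lam) / 512) := ⟨_, rfl⟩
  have hc1p : 0 < c1 := by rw [hc1]; positivity
  obtain ⟨m, hm⟩ : ∃ m : ℝ, m = α * (2 * K + 2) := ⟨_, rfl⟩
  have hmp : 0 < m := by rw [hm]; positivity
  obtain ⟨c2, hc2⟩ : ∃ c2 : ℝ, c2 = α * (1 - lam) / 256 := ⟨_, rfl⟩
  have hc2p : 0 < c2 := by rw [hc2]; positivity
  obtain ⟨γ, hγ⟩ : ∃ γ : ℝ, γ = c1 / (2 * (c1 + m)) := ⟨_, rfl⟩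
  have hγp : 0 < γ := by rw [hγ]; positivity
  have hγe : γ * (c1 + m) = c1 / 2 := by rw [hγ]; field_simp
  have hγ1 : γ < 1 := by nlinarith
  refine ⟨α, hα, by linarith, γ, hγp, hγ1, min (c1 / 2) (γ * c2), by positivity, ?_⟩
  intro O l x y X Y hxy _ _
  have hl : l ++ [(x, y), (X, Y)] = (l ++ [(x, y)]) ++ [(X, Y)] := by simp
  rw [hl]
  have hP : Pair (WF O (l ++ [(x, y)])) (WF O ((l ++ [(x, y)]) ++ [(X, Y)])) O x y X Y :=
    { w := ⟨WF_lip _ O, WF_ge _ O, WF_snoc_rep (x, y) l O⟩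
      v := ⟨WF_lip _ O, WF_ge _ O, WF_snoc_rep (X, Y) _ O⟩
      eq := fun t ht => WF_snoc_eq (X, Y) _ O t ht
      le := WF_snoc_ge (X, Y) _ O
      hxy := hxy }
  generalize WF O ((l ++ [(x, y)]) ++ [(X, Y)]) = V at hP
  generalize WF O (l ++ [(x, y)]) = W at hP
  have hdx := Sl_le_dx h0 h1 hP
  have hbdd : BddAbove (Set.range fun s => Sl lam W s (req (X, Y))) :=
    ⟨2 * |x - X|, by rintro _ ⟨s, rfl⟩; exact hdx s⟩
  have hD1 : ∀ s, Sl lam W s (req (X, Y)) ≤ sSup (Set.range fun s => Sl lam W s (req (X, Y))) :=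
    fun s => le_csSup hbdd ⟨s, rfl⟩
  have hD2 : sSup (Set.range fun s => Sl lam W s (req (X, Y))) ≤ 2 * |x - X| :=
    csSup_le (Set.range_nonempty _) (by rintro _ ⟨s, rfl⟩; exact hdx s)
  have hD3 : ∀ b < sSup (Set.range fun s => Sl lam W s (req (X, Y))),
      ∃ s, b < Sl lam W s (req (X, Y)) := by
    intro b hb
    obtain ⟨_, ⟨s, rfl⟩, h⟩ := exists_lt_of_lt_csSup (Set.range_nonempty _) hb
    exact ⟨s, h⟩
  generalize sSup (Set.range fun s => Sl lam W s (req (X, Y))) = D at hD1 hD2 hD3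
  have hF0 : infF lam α W ≤ infF lam α V :=
    le_infF h0 h1 hα hα2 hP fun t1 _ t2 _ t3 _ => infF_le h0 hα hb hP.w t1 t2 t3
  have hG0 : ∀ E, 0 ≤ E → D ≤ E → infG lam α W - m * E ≤ infG lam α V := by
    intro E hE hDE
    apply le_infG h0 h1 hα hα2 hP
    intro t1 k1 t2 k2 t3 k3
    rw [hm]
    exact G0 h0 h1 hα hα2 hb hP hK hE (fun s => (hD1 s).trans hDE) k1 k2 k3
  have hc5 : 0 < min (c1 / 2) (γ * c2) := by positivity
  have hc5a : min (c1 / 2) (γ * c2) ≤ c1 / 2 := min_le_left _ _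
  have hc5b : min (c1 / 2) (γ * c2) ≤ γ * c2 := min_le_right _ _
  generalize min (c1 / 2) (γ * c2) = c5 at hc5 hc5a hc5b
  unfold Phi
  have hF0' : (1 - γ) * infF lam α W ≤ (1 - γ) * infF lam α V :=
    mul_le_mul_of_nonneg_left hF0 (by linarith)
  rcases le_or_gt D 0 with hD | hD
  · have a := hG0 0 le_rfl hD
    have b : γ * infG lam α W ≤ γ * infG lam α V :=
      mul_le_mul_of_nonneg_left (by linarith) hγp.le
    have c : c5 * D ≤ 0 := mul_nonpos_of_nonneg_of_nonpos hc5.le hD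
    linarith
  obtain ⟨s, hs⟩ := hD3 (D / 2) (by linarith)
  rcases lt_or_ge ((1 - lam) / 512 * D) |y - Y| with hy | hy
  · have a : infF lam α W + c1 * D ≤ infF lam α V := by
      apply le_infF h0 h1 hα hα2 hP
      intro t1 k1 t2 k2 t3 k3
      have := caseI h0 h1 hα hα2 hb hP hD hs.le hy k1 k2 k3
      rw [hc1]
      linarith
    have b := hG0 D hD.le le_rfl
    have a' := mul_le_mul_of_nonneg_left a (by linarith : 0 ≤ 1 - γ)
    have b' := mul_le_mul_of_nonneg_left b hγp.le
    have c := mul_le_mul_of_nonneg_right hc5a hD.le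
    have d : γ * c1 * D + γ * m * D = c1 / 2 * D := by rw [← hγe]; ring
    linarith
  · have a : infG lam α W + c2 * D ≤ infG lam α V := by
      apply le_infG h0 h1 hα hα2 hP
      intro t1 k1 t2 k2 t3 k3
      rw [hc2]
      exact caseII h0 h1 hα hα2 hb hP hD hD2 hs.le hy k1 k2 k3
    have a' := mul_le_mul_of_nonneg_left a hγp.le
    have c := mul_le_mul_of_nonneg_right hc5b hD.le
    linarith
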